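/- Let {p_k, ρ_k} be an arbitrary countable ensemble of states in 𝔖(ℋ) (p_k ≥ 0, Σ_k p_k = 1). Then Σ_k q_k S(σ_k) ≥ Σ_k S̃([p_kρ_k − εI]₊) − h↑(ε) for any countable ensemble {q_k, σ_k} of states in 𝔖(ℋ) such that ½ Σ_k ‖p_kρ_k − q_kσ_k‖₁ ≤ ε ∈ (0,1]. -/

import Mathlib

open scoped ENNReal InnerProductSpace
open MeasureTheory

noncomputable section

namespace AFW

attribute [local instance] Classical.propDecidable

variable {𝓗 : Type*} [NormedAddCommGroup 𝓗] [InnerProductSpace ℂ 𝓗] [CompleteSpace 𝓗]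

/-- Trace-type functional: on positive operators it is the trace; on self-adjoint
trace-class operators it is the trace norm `‖·‖₁`. -/
def trNorm (T : 𝓗 →L[ℂ] 𝓗) : ℝ≥0∞ :=
  ⨆ (s : Set 𝓗) (_ : Orthonormal ℂ (Subtype.val : s → 𝓗)),
    ∑' x : s, (‖⟪(x : 𝓗), T x⟫_ℂ‖₊ : ℝ≥0∞)

/-- `ρ` is a quantum state: a positive (trace-class) operator with unit trace. -/
def IsState (ρ : 𝓗 →L[ℂ] 𝓗) : Prop := ρ.IsPositive ∧ trNorm ρ = 1

/-- `ρ ∧ εI` (spectral cut-off from above). -/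
def cut (ρ : 𝓗 →L[ℂ] 𝓗) (ε : ℝ) : 𝓗 →L[ℂ] 𝓗 := cfc (fun x : ℝ => min x ε) ρ

/-- `[ρ − εI]₊`. -/
def cutAbove (ρ : 𝓗 →L[ℂ] 𝓗) (ε : ℝ) : 𝓗 →L[ℂ] 𝓗 := cfc (fun x : ℝ => max (x - ε) 0) ρ

/-- positive part `[T]₊` of a self-adjoint operator. -/
def posP (T : 𝓗 →L[ℂ] 𝓗) : 𝓗 →L[ℂ] 𝓗 := cfc (fun x : ℝ => max x 0) T

/-- negative part `[T]₋` of a self-adjoint operator. -/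
def negP (T : 𝓗 →L[ℂ] 𝓗) : 𝓗 →L[ℂ] 𝓗 := cfc (fun x : ℝ => max (-x) 0) T

def sqrtOp (T : 𝓗 →L[ℂ] 𝓗) : 𝓗 →L[ℂ] 𝓗 := cfc Real.sqrt T

def eta (x : ℝ) : ℝ := -(x * Real.log x)

/-- The von Neumann entropy `S(ρ) = Tr η(ρ)`, with values in `[0,+∞]`. -/
def entropy (ρ : 𝓗 →L[ℂ] 𝓗) : ℝ≥0∞ := trNorm (cfc eta ρ)

/-- Homogeneous extension `S̃` of the von Neumann entropy to the positive cone. -/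
def entExt (ρ : 𝓗 →L[ℂ] 𝓗) : ℝ≥0∞ :=
  if ρ = 0 then 0 else trNorm ρ * entropy ((trNorm ρ).toReal⁻¹ • ρ)

def binEnt (p : ℝ) : ℝ := eta p + eta (1 - p)

def binEntUp (x : ℝ) : ℝ := if x ≤ 1 / 2 then binEnt x else Real.log 2

def etaUp (x : ℝ) : ℝ := if x ≤ (Real.exp 1)⁻¹ then eta x else (Real.exp 1)⁻¹

/-- nondecreasing modification `a↑` used for control functions. -/
def up (a : ℝ → ℝ) (x : ℝ) : ℝ := if x ≤ 1 / 2 then a x else a (1 / 2)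

/-- Control functions for LAA functions. -/
structure ControlPair (a b : ℝ → ℝ) : Prop where
  conta : ContinuousOn a (Set.Icc 0 1)
  contb : ContinuousOn b (Set.Icc 0 1)
  zeroa : a 0 = 0
  zerob : b 0 = 0
  cva : ConcaveOn ℝ (Set.Icc 0 (1 / 2)) a
  cvb : ConcaveOn ℝ (Set.Icc 0 (1 / 2)) b
  mona : MonotoneOn a (Set.Icc 0 (1 / 2))
  monb : MonotoneOn b (Set.Icc 0 (1 / 2))

/-- `f` is locally almost affine on `S0` with control functions `a`, `b`. -/
def IsLAA (S0 : Set (𝓗 →L[ℂ] 𝓗)) (f : (𝓗 →L[ℂ] 𝓗) → EReal) (a b : ℝ → ℝ) : Prop :=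
  ∀ ρ ∈ S0, ∀ σ ∈ S0, ∀ p : ℝ, 0 ≤ p → p ≤ 1 →
    ((p : EReal) * f ρ + ((1 - p : ℝ) : EReal) * f σ) - ((a p : ℝ) : EReal)
        ≤ f (p • ρ + (1 - p) • σ) ∧
      f (p • ρ + (1 - p) • σ)
        ≤ ((p : EReal) * f ρ + ((1 - p : ℝ) : EReal) * f σ) + ((b p : ℝ) : EReal)

/-- Homogeneous extension of `f` to the cone generated by its domain. -/
def homExt (f : (𝓗 →L[ℂ] 𝓗) → EReal) (T : 𝓗 →L[ℂ] 𝓗) : EReal :=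
  if T = 0 then 0 else (trNorm T : EReal) * f ((trNorm T).toReal⁻¹ • T)

/-- The barycenter `Ω(μ)` of the family `w` with respect to `μ`. -/
def Omega {X : Type*} [MeasurableSpace X] (w : X → 𝓗 →L[ℂ] 𝓗) (μ : Measure X) :
    𝓗 →L[ℂ] 𝓗 := ∫ x, w x ∂μ

/-- The quasi-classical set of states generated by `(X, 𝔉, w)`. -/
def QSet {X : Type*} [MeasurableSpace X] (w : X → 𝓗 →L[ℂ] 𝓗) : Set (𝓗 →L[ℂ] 𝓗) :=
  {ρ | ∃ μ : Measure X, IsProbabilityMeasure μ ∧ ρ = Omega w μ}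

/-- Total variation distance between measures. -/
def TV {X : Type*} [MeasurableSpace X] (μ ν : Measure X) : ℝ≥0∞ :=
  ⨆ (A : Set X) (_ : MeasurableSet A), (μ A - ν A) ⊔ (ν A - μ A)

/-- `Tr H ρ` for a positive operator `H = Σ h_k |τ_k⟩⟨τ_k|` given by discrete spectral data. -/
def energy (h : ℕ → ℝ) (τ : ℕ → 𝓗) (ρ : 𝓗 →L[ℂ] 𝓗) : ℝ≥0∞ :=
  if LinearMap.range (ρ : 𝓗 →ₗ[ℂ] 𝓗) ≤ (Submodule.span ℂ (Set.range τ)).topologicalClosure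
  then ∑' k, ENNReal.ofReal (h k * (⟪τ k, ρ (τ k)⟫_ℂ).re)
  else ⊤

/-- A positive operator with discrete spectral representation `Σ h_k |τ_k⟩⟨τ_k|`
(nondecreasing nonnegative eigenvalue sequence, orthonormal eigenvectors). -/
structure DiscreteOp (h : ℕ → ℝ) (τ : ℕ → 𝓗) : Prop where
  ortho : Orthonormal ℂ τ
  nonneg : ∀ k, 0 ≤ h k
  mono : Monotone h

/-- The Gibbs condition `Tr e^{−βH} < ∞` for all `β > 0`. -/
def GibbsCondition (h : ℕ → ℝ) : Prop := ∀ β : ℝ, 0 < β → Summable fun k => Real.exp (-β * h k)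

/-- `F_H(E) = sup { S(ρ) : Tr Hρ ≤ E }`. -/
def FH (h : ℕ → ℝ) (τ : ℕ → 𝓗) (E : ℝ≥0∞) : ℝ≥0∞ :=
  ⨆ (ϑ : 𝓗 →L[ℂ] 𝓗) (_ : IsState ϑ) (_ : energy h τ ϑ ≤ E), entropy ϑ

/-- `Tr(ρ M)` for positive `ρ`, `M`, computed as `Tr(√ρ M √ρ)`. -/
def trPair (ρ M : 𝓗 →L[ℂ] 𝓗) : ℝ≥0∞ := trNorm (sqrtOp ρ * M * sqrtOp ρ)

/-- classical relative entropy of two finite tuples. -/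
def klFin {n : ℕ} (p q : Fin n → ℝ) : ℝ≥0∞ :=
  if ∀ i, q i = 0 → p i = 0 then
    ENNReal.ofReal (∑ i, if p i = 0 then 0 else p i * Real.log (p i / q i))
  else ⊤

/-- The quantum relative entropy `D(ρ‖σ)`, realized as the supremum of classical
relative entropies of outcome distributions over all finite quantum measurements. -/
def relEnt (ρ σ : 𝓗 →L[ℂ] 𝓗) : ℝ≥0∞ :=
  ⨆ (n : ℕ) (M : Fin n → 𝓗 →L[ℂ] 𝓗) (_ : ∀ i, (M i).IsPositive) (_ : ∑ i, M i = 1),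
    klFin (fun i => (trPair ρ (M i)).toReal) (fun i => (trPair σ (M i)).toReal)

/-- rank of an operator (junk value `0` if infinite). -/
def opRank (T : 𝓗 →L[ℂ] 𝓗) : ℕ := Module.finrank ℂ (LinearMap.range (T : 𝓗 →ₗ[ℂ] 𝓗))

/-- a positive trace-preserving linear map (such as a partial trace). -/
def IsMarginal {𝓚 : Type*} [NormedAddCommGroup 𝓚] [InnerProductSpace ℂ 𝓚] [CompleteSpace 𝓚]
    (Λ : (𝓗 →L[ℂ] 𝓗) →ₗ[ℂ] (𝓚 →L[ℂ] 𝓚)) : Prop :=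
  (∀ T : 𝓗 →L[ℂ] 𝓗, T.IsPositive → (Λ T).IsPositive) ∧
  (∀ T : 𝓗 →L[ℂ] 𝓗, T.IsPositive → trNorm (Λ T) = trNorm T)

end AFW

namespace AFW

section TraceNorm

variable {𝓗 : Type*} [NormedAddCommGroup 𝓗] [InnerProductSpace ℂ 𝓗]

/-- The real quadratic form `Re ⟪x, T x⟫` of an operator `T`. -/
def quadForm (T : 𝓗 →L[ℂ] 𝓗) (x : 𝓗) : ℝ := (⟪x, T x⟫_ℂ).re

lemma quadForm_nonneg {T : 𝓗 →L[ℂ] 𝓗} (hT : T.IsPositive) (x : 𝓗) : 0 ≤ quadForm T x :=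
  hT.re_inner_nonneg_right x

lemma quadForm_mono {S T : 𝓗 →L[ℂ] 𝓗} (h : S ≤ T) (x : 𝓗) : quadForm S x ≤ quadForm T x := by
  have := quadForm_nonneg ((ContinuousLinearMap.le_def S T).1 h) x
  simp only [quadForm, sub_apply, inner_sub_right, Complex.sub_re] at this ⊢
  linarith

lemma quadForm_smul_left (c : ℝ) (T : 𝓗 →L[ℂ] 𝓗) (x : 𝓗) :
    quadForm (c • T) x = c * quadForm T x := by
  simp [quadForm, inner_smul_right_eq_smul]

lemma quadForm_sub_left (S T : 𝓗 →L[ℂ] 𝓗) (x : 𝓗) :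
    quadForm (S - T) x = quadForm S x - quadForm T x := by
  simp [quadForm]

lemma quadForm_smul_right (T : 𝓗 →L[ℂ] 𝓗) (c : ℝ) (x : 𝓗) :
    quadForm T (c • x) = c ^ 2 * quadForm T x := by
  have h : T (c • x) = c • T x := T.map_smul_of_tower c x
  simp only [quadForm, h, inner_smul_right_eq_smul, inner_smul_left_eq_smul]
  simp; ring

lemma ofReal_abs_quadForm_le (T : 𝓗 →L[ℂ] 𝓗) (x : 𝓗) :
    ENNReal.ofReal |quadForm T x| ≤ (‖⟪x, T x⟫_ℂ‖₊ : ℝ≥0∞) := by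
  rw [← enorm_eq_nnnorm, ← ofReal_norm]
  exact ENNReal.ofReal_le_ofReal (Complex.abs_re_le_norm _)

lemma nnnorm_inner_eq_ofReal_quadForm {T : 𝓗 →L[ℂ] 𝓗} (hT : T.IsPositive) (x : 𝓗) :
    (‖⟪x, T x⟫_ℂ‖₊ : ℝ≥0∞) = ENNReal.ofReal (quadForm T x) := by
  rw [← enorm_eq_nnnorm, ← ofReal_norm, quadForm]
  rw [Complex.eq_coe_norm_of_nonneg (hT.inner_nonneg_right x), Complex.ofReal_re, Complex.norm_real,
    norm_norm]

lemma tsum_nnnorm_inner_le_trNorm {ι : Type*} {u : ι → 𝓗} (hu : Orthonormal ℂ u)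
    (T : 𝓗 →L[ℂ] 𝓗) : ∑' i, (‖⟪u i, T (u i)⟫_ℂ‖₊ : ℝ≥0∞) ≤ trNorm T := by
  have hinj := hu.linearIndependent.injective
  rw [← (Equiv.ofInjective u hinj).symm.tsum_eq]
  refine le_trans (le_of_eq (tsum_congr fun x => ?_))
    (le_iSup₂ (f := fun (s : Set 𝓗) (_ : Orthonormal ℂ (Subtype.val : s → 𝓗)) =>
      ∑' x : s, (‖⟪(x : 𝓗), T x⟫_ℂ‖₊ : ℝ≥0∞)) (Set.range u) hu.toSubtypeRange)
  rw [Equiv.apply_ofInjective_symm hinj]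

lemma tsum_abs_quadForm_le_trNorm {ι : Type*} {u : ι → 𝓗} (hu : Orthonormal ℂ u)
    (T : 𝓗 →L[ℂ] 𝓗) : ∑' i, ENNReal.ofReal |quadForm T (u i)| ≤ trNorm T :=
  (ENNReal.tsum_le_tsum fun _ => ofReal_abs_quadForm_le T _).trans
    (tsum_nnnorm_inner_le_trNorm hu T)

lemma tsum_quadForm_le_trNorm {ι : Type*} {u : ι → 𝓗} (hu : Orthonormal ℂ u)
    (T : 𝓗 →L[ℂ] 𝓗) : ∑' i, ENNReal.ofReal (quadForm T (u i)) ≤ trNorm T :=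
  (ENNReal.tsum_le_tsum fun _ => ENNReal.ofReal_le_ofReal (le_abs_self _)).trans
    (tsum_abs_quadForm_le_trNorm hu T)

lemma tsum_sq_norm_inner_le {ι : Type*} {u : ι → 𝓗} (hu : Orthonormal ℂ u) (v : 𝓗) :
    ∑' i, ENNReal.ofReal (‖⟪u i, v⟫_ℂ‖ ^ 2) ≤ ENNReal.ofReal (‖v‖ ^ 2) := by
  rw [← ENNReal.ofReal_tsum_of_nonneg (fun _ => by positivity) (hu.inner_products_summable v)]
  exact ENNReal.ofReal_le_ofReal (hu.tsum_inner_products_le v)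

lemma ofReal_sq_norm_eq_tsum {ι : Type*} (b : HilbertBasis ι ℂ 𝓗) (v : 𝓗) :
    ENNReal.ofReal (‖v‖ ^ 2) = ∑' i, ENNReal.ofReal (‖⟪b i, v⟫_ℂ‖ ^ 2) := by
  rw [← ENNReal.ofReal_tsum_of_nonneg (fun _ => by positivity)
    (b.orthonormal.inner_products_summable v)]
  congr 1
  have h := (b.hasSum_inner_mul_inner v v).mapL Complex.reCLM
  have h2 : ∀ i, Complex.reCLM (⟪v, b i⟫_ℂ * ⟪b i, v⟫_ℂ) = ‖⟪b i, v⟫_ℂ‖ ^ 2 := fun i => by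
    refine (inner_mul_symm_re_eq_norm (𝕜 := ℂ) v (b i)).trans ?_
    rw [norm_mul, norm_inner_symm v (b i), sq]
  simp only [h2] at h
  rw [h.tsum_eq, ← inner_self_eq_norm_sq (𝕜 := ℂ)]
  rfl

lemma quadForm_eq_sq_norm {T Y : 𝓗 →L[ℂ] 𝓗} (hY : ∀ x y, ⟪Y x, y⟫_ℂ = ⟪x, Y y⟫_ℂ)
    (hT : ∀ x, T x = Y (Y x)) (x : 𝓗) : quadForm T x = ‖Y x‖ ^ 2 := by
  rw [quadForm, hT, ← hY, ← inner_self_eq_norm_sq (𝕜 := ℂ)]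
  rfl

/-- The trace norm of an operator bounds its quadratic form. -/
lemma quadForm_le_of_trNorm_le_one {T : 𝓗 →L[ℂ] 𝓗} (h : trNorm T ≤ 1) (x : 𝓗) :
    quadForm T x ≤ ‖x‖ ^ 2 := by
  by_cases hx : x = 0
  · simp [hx, quadForm]
  have hn : 0 < ‖x‖ := norm_pos_iff.2 hx
  have hu : Orthonormal ℂ (fun _ : Unit => (‖x‖⁻¹ : ℝ) • x) := by
    refine ⟨fun _ => ?_, fun i j hij => (hij (Subsingleton.elim i j)).elim⟩
    rw [norm_smul, norm_inv, norm_norm, inv_mul_cancel₀ hn.ne']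
  have h2 := (tsum_quadForm_le_trNorm hu T).trans h
  rw [tsum_fintype] at h2
  simp only [Finset.univ_unique, Finset.sum_const, Finset.card_singleton, one_smul,
    ENNReal.ofReal_le_one, quadForm_smul_right] at h2
  have := mul_le_mul_of_nonneg_left h2 (sq_nonneg ‖x‖)
  rwa [← mul_assoc, inv_pow, mul_inv_cancel₀ (pow_pos hn 2).ne', one_mul, mul_one] at this

/-- A subspace on which a trace-class operator is bounded below is finite-dimensional. -/
lemma finiteDimensional_of_le_quadForm {A : 𝓗 →L[ℂ] 𝓗} (htr : trNorm A ≠ ⊤) {ε : ℝ} (hε : 0 < ε)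
    (V : Submodule ℂ 𝓗) (h : ∀ x ∈ V, ε * ‖x‖ ^ 2 ≤ quadForm A x) : FiniteDimensional ℂ V := by
  obtain ⟨n, hn⟩ := exists_nat_gt ((trNorm A).toReal / ε)
  rw [div_lt_iff₀ hε] at hn
  refine Module.rank_lt_aleph0_iff.1 ((rank_le (n := n) fun s hs => ?_).trans_lt
    (Cardinal.natCast_lt_aleph0))
  let W : Submodule ℂ V := Submodule.span ℂ (s : Set V)
  have hW : Module.finrank ℂ W = s.card := finrank_span_finset_eq_card hs
  let b := stdOrthonormalBasis ℂ W
  have hu : Orthonormal ℂ (fun i => ((b i : V) : 𝓗)) :=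
    (b.orthonormal.comp_linearIsometry W.subtypeₗᵢ).comp_linearIsometry V.subtypeₗᵢ
  have h1 := tsum_quadForm_le_trNorm hu A
  have h2 : ENNReal.ofReal (s.card * ε) ≤ trNorm A := by
    refine le_trans ?_ h1
    rw [tsum_fintype, ← hW, ENNReal.ofReal_mul (by positivity), ENNReal.ofReal_natCast,
      ← nsmul_eq_mul]
    refine (le_of_eq ?_).trans (Finset.card_nsmul_le_sum Finset.univ _ (ENNReal.ofReal ε)
      fun i _ => ENNReal.ofReal_le_ofReal ?_)
    · simp
    · simpa [hu.1 i] using h _ (b i : V).2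
  rw [ENNReal.ofReal_le_iff_le_toReal htr] at h2
  have h3 : (s.card : ℝ) < n := lt_of_mul_lt_mul_right (h2.trans_lt hn) hε.le
  exact_mod_cast h3.le

/-- A symmetric operator is diagonal in some orthonormal basis of a finite-dimensional subspace. -/
lemma exists_orthonormal_diagonalizing (V : Submodule ℂ 𝓗) [FiniteDimensional ℂ V]
    {T : 𝓗 →L[ℂ] 𝓗} (hT : T.IsPositive) :
    ∃ b : OrthonormalBasis (Fin (Module.finrank ℂ V)) ℂ V,
      ∀ i j, i ≠ j → ⟪(b i : 𝓗), T (b j)⟫_ℂ = 0 := by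
  let S : V →ₗ[ℂ] V := (V.orthogonalProjectionOnto : 𝓗 →ₗ[ℂ] V) ∘ₗ (T : 𝓗 →ₗ[ℂ] 𝓗) ∘ₗ V.subtype
  have hS : ∀ x y : V, ⟪x, S y⟫_ℂ = ⟪(x : 𝓗), T y⟫_ℂ := fun x y =>
    V.inner_orthogonalProjectionOnto_eq_of_mem_left x (T y)
  have hsym : S.IsSymmetric := fun x y => by
    rw [hS, ← inner_conj_symm, hS, inner_conj_symm]
    exact hT.isSymmetric x y
  refine ⟨hsym.eigenvectorBasis rfl, fun i j hij => ?_⟩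
  rw [← hS, hsym.apply_eigenvectorBasis, inner_smul_right,
    (hsym.eigenvectorBasis rfl).orthonormal.inner_eq_zero hij, mul_zero]

variable [CompleteSpace 𝓗]

/-- A positive operator has a self-adjoint square root. -/
lemma exists_sqrt {T : 𝓗 →L[ℂ] 𝓗} (hT : T.IsPositive) :
    ∃ Y : 𝓗 →L[ℂ] 𝓗, (∀ x y, ⟪Y x, y⟫_ℂ = ⟪x, Y y⟫_ℂ) ∧ ∀ x, T x = Y (Y x) := by
  have h0 : 0 ≤ T := (ContinuousLinearMap.nonneg_iff_isPositive T).2 hT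
  refine ⟨CFC.sqrt T, fun x y => ?_, fun x => ?_⟩
  · exact ((ContinuousLinearMap.nonneg_iff_isPositive _).1 (CFC.sqrt_nonneg T)).isSymmetric x y
  · conv_lhs => rw [← CFC.sqrt_mul_sqrt_self T h0]
    rfl

lemma apply_eq_zero_of_quadForm_eq_zero {T : 𝓗 →L[ℂ] 𝓗} (hT : T.IsPositive) {x : 𝓗}
    (h : quadForm T x = 0) : T x = 0 := by
  obtain ⟨Y, hY, hTY⟩ := exists_sqrt hT
  rw [quadForm_eq_sq_norm hY hTY] at h
  have : Y x = 0 := by simpa using h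
  rw [hTY, this, map_zero]

lemma trNorm_le_tsum_hilbertBasis {ι : Type*} (b : HilbertBasis ι ℂ 𝓗) {T : 𝓗 →L[ℂ] 𝓗}
    (hT : T.IsPositive) : trNorm T ≤ ∑' i, ENNReal.ofReal (quadForm T (b i)) := by
  obtain ⟨Y, hY, hTY⟩ := exists_sqrt hT
  refine iSup₂_le fun s hs => ?_
  calc ∑' x : s, (‖⟪(x : 𝓗), T x⟫_ℂ‖₊ : ℝ≥0∞)
      = ∑' x : s, ∑' i, ENNReal.ofReal (‖⟪b i, Y x⟫_ℂ‖ ^ 2) := tsum_congr fun x => by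
        rw [nnnorm_inner_eq_ofReal_quadForm hT, quadForm_eq_sq_norm hY hTY,
          ofReal_sq_norm_eq_tsum b]
    _ = ∑' i, ∑' x : s, ENNReal.ofReal (‖⟪b i, Y x⟫_ℂ‖ ^ 2) := ENNReal.tsum_comm
    _ = ∑' i, ∑' x : s, ENNReal.ofReal (‖⟪(x : 𝓗), Y (b i)⟫_ℂ‖ ^ 2) := by
        refine tsum_congr fun i => tsum_congr fun x => ?_
        rw [← hY, norm_inner_symm]
    _ ≤ ∑' i, ENNReal.ofReal (‖Y (b i)‖ ^ 2) :=
        ENNReal.tsum_le_tsum fun i => tsum_sq_norm_inner_le hs _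
    _ = _ := by simp only [quadForm_eq_sq_norm hY hTY]

/-- The trace of a positive operator is computed by every orthonormal family whose orthogonal
complement lies in its kernel. -/
lemma trNorm_eq_tsum {ι : Type*} {u : ι → 𝓗} (hu : Orthonormal ℂ u) {T : 𝓗 →L[ℂ] 𝓗}
    (hT : T.IsPositive) (hker : ∀ x, (∀ i, ⟪u i, x⟫_ℂ = 0) → T x = 0) :
    trNorm T = ∑' i, ENNReal.ofReal (quadForm T (u i)) := by
  refine le_antisymm ?_ (tsum_quadForm_le_trNorm hu T)
  obtain ⟨w, b, hw, hb⟩ := hu.toSubtypeRange.exists_hilbertBasis_extension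
  refine (trNorm_le_tsum_hilbertBasis b hT).trans_eq ?_
  let e : ι → w := fun i => ⟨u i, hw ⟨i, rfl⟩⟩
  have he : Function.Injective e := fun i j hij =>
    hu.linearIndependent.injective (congrArg Subtype.val hij)
  have hbe : ∀ j : w, b j = j := fun j => congrFun hb j
  refine (he.tsum_eq (f := fun j => ENNReal.ofReal (quadForm T (b j))) ?_).symm.trans
    (tsum_congr fun i => by rw [hbe])
  intro j hj
  by_contra hne
  refine hj ?_
  have : T (b j) = 0 := hker _ fun i => by
    have hij : e i ≠ j := fun h => hne ⟨i, h⟩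
    have := b.orthonormal.inner_eq_zero hij
    rwa [hbe (e i)] at this
  simp [quadForm, this]

lemma trNorm_eq_tsum_hilbertBasis {ι : Type*} (b : HilbertBasis ι ℂ 𝓗) {T : 𝓗 →L[ℂ] 𝓗}
    (hT : T.IsPositive) : trNorm T = ∑' i, ENNReal.ofReal (quadForm T (b i)) :=
  (trNorm_le_tsum_hilbertBasis b hT).antisymm (tsum_quadForm_le_trNorm b.orthonormal T)

end TraceNorm

lemma eta_le_tangent {x r : ℝ} (hx : 0 ≤ x) (hr : 0 < r) :
    eta x ≤ (-Real.log r - 1) * x + 0 * x ^ 2 + r := by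
  rcases hx.eq_or_lt with rfl | hx
  · simpa [eta] using hr.le
  · have h := mul_le_mul_of_nonneg_left (Real.log_le_sub_one_of_pos (div_pos hr hx)) hx.le
    rw [Real.log_div hr.ne' hx.ne', mul_sub, mul_sub, mul_div_cancel₀ _ hx.ne'] at h
    rw [eta]
    linarith

lemma quadratic_le_eta {x r : ℝ} (hx : 0 ≤ x) (hr : 0 < r) :
    (1 - Real.log r) * x + (-r⁻¹) * x ^ 2 + 0 ≤ eta x := by
  rcases hx.eq_or_lt with rfl | hx
  · simp [eta]
  · have h := mul_le_mul_of_nonneg_left (Real.log_le_sub_one_of_pos (div_pos hx hr)) hx.le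
    rw [Real.log_div hx.ne' hr.ne', div_eq_mul_inv] at h
    rw [eta]
    linarith

lemma continuous_eta : Continuous eta := by
  unfold eta
  exact Real.continuous_mul_log.neg

lemma eta_nonneg {x : ℝ} (h0 : 0 ≤ x) (h1 : x ≤ 1) : 0 ≤ eta x := by
  have := mul_nonpos_of_nonneg_of_nonpos h0 (Real.log_nonpos h0 h1)
  rw [eta]
  linarith

section FunctionalCalculus

variable {𝓗 : Type*} [NormedAddCommGroup 𝓗] [InnerProductSpace ℂ 𝓗] [CompleteSpace 𝓗]

lemma spectrum_nonneg {T : 𝓗 →L[ℂ] 𝓗} (hT : T.IsPositive) {x : ℝ} (hx : x ∈ spectrum ℝ T) :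
    0 ≤ x :=
  spectrum_nonneg_of_nonneg ((ContinuousLinearMap.nonneg_iff_isPositive T).2 hT) hx

lemma isPositive_cfc {T : 𝓗 →L[ℂ] 𝓗} {f : ℝ → ℝ} (h : ∀ x ∈ spectrum ℝ T, 0 ≤ f x) :
    (cfc f T).IsPositive :=
  (ContinuousLinearMap.nonneg_iff_isPositive _).1 (cfc_nonneg h)

lemma quadForm_cfc_quadratic {T : 𝓗 →L[ℂ] 𝓗} (hT : T.IsPositive) (a b c : ℝ) (x : 𝓗) :
    quadForm (cfc (fun t : ℝ => a * t + b * t ^ 2 + c) T) x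
      = a * quadForm T x + b * ‖T x‖ ^ 2 + c * ‖x‖ ^ 2 := by
  have hsa : IsSelfAdjoint T := hT.isSelfAdjoint
  have h : cfc (fun t : ℝ => a * t + b * t ^ 2 + c) T
      = a • T + b • (T * T) + c • (1 : 𝓗 →L[ℂ] 𝓗) := by
    rw [cfc_add (a := T) (fun t : ℝ => a * t + b * t ^ 2) (fun _ => c),
      cfc_add (a := T) (fun t : ℝ => a * t) (fun t => b * t ^ 2),
      cfc_const_mul a (fun t : ℝ => t) T, cfc_const_mul b (fun t : ℝ => t ^ 2) T,
      cfc_pow (fun t : ℝ => t) 2 T, cfc_id' ℝ T, cfc_const c T, sq, Algebra.algebraMap_eq_smul_one]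
  rw [h, ← inner_self_eq_norm_sq (𝕜 := ℂ) (T x), ← inner_self_eq_norm_sq (𝕜 := ℂ) x,
    hT.inner_left_eq_inner_right]
  simp [quadForm, inner_smul_right_eq_smul]

lemma quadForm_cfc_le_quadratic {T : 𝓗 →L[ℂ] 𝓗} (hT : T.IsPositive) {f : ℝ → ℝ}
    (hf : Continuous f) {a b c : ℝ} (h : ∀ t, 0 ≤ t → f t ≤ a * t + b * t ^ 2 + c) (x : 𝓗) :
    quadForm (cfc f T) x ≤ a * quadForm T x + b * ‖T x‖ ^ 2 + c * ‖x‖ ^ 2 := by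
  rw [← quadForm_cfc_quadratic hT]
  exact quadForm_mono (cfc_mono (fun t ht => h t (spectrum_nonneg hT ht)) hf.continuousOn
    (by fun_prop)) x

lemma quadratic_le_quadForm_cfc {T : 𝓗 →L[ℂ] 𝓗} (hT : T.IsPositive) {f : ℝ → ℝ}
    (hf : Continuous f) {a b c : ℝ} (h : ∀ t, 0 ≤ t → a * t + b * t ^ 2 + c ≤ f t) (x : 𝓗) :
    a * quadForm T x + b * ‖T x‖ ^ 2 + c * ‖x‖ ^ 2 ≤ quadForm (cfc f T) x := by
  rw [← quadForm_cfc_quadratic hT]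
  exact quadForm_mono (cfc_mono (fun t ht => h t (spectrum_nonneg hT ht)) (by fun_prop)
    hf.continuousOn) x

lemma cutAbove_isPositive (A : 𝓗 →L[ℂ] 𝓗) (ε : ℝ) : (cutAbove A ε).IsPositive :=
  isPositive_cfc fun _ _ => le_max_right _ _

lemma cutAbove_apply_cutAbove {A : 𝓗 →L[ℂ] 𝓗} (hA : A.IsPositive) (ε : ℝ) (y : 𝓗) :
    cutAbove A ε (cutAbove A ε y) = A (cutAbove A ε y) - ε • cutAbove A ε y := by
  have hsa : IsSelfAdjoint A := hA.isSelfAdjoint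
  have h : cutAbove A ε * cutAbove A ε = (A - ε • (1 : 𝓗 →L[ℂ] 𝓗)) * cutAbove A ε := by
    have h1 : A - ε • (1 : 𝓗 →L[ℂ] 𝓗) = cfc (fun t : ℝ => t - ε) A := by
      rw [cfc_sub (a := A) (fun t : ℝ => t) (fun _ => ε), cfc_id' ℝ A, cfc_const ε A,
        Algebra.algebraMap_eq_smul_one]
    rw [h1, cutAbove, ← cfc_mul .., ← cfc_mul ..]
    congr 1
    ext t
    rcases le_total (t - ε) 0 with h | h <;> simp [h]
  simpa using congrArg (fun S : 𝓗 →L[ℂ] 𝓗 => S y) h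

lemma isPositive_cfc_eta {T : 𝓗 →L[ℂ] 𝓗} (hT : T.IsPositive) (h : trNorm T ≤ 1) :
    (cfc eta T).IsPositive := by
  have hsa : IsSelfAdjoint T := hT.isSelfAdjoint
  have h1 : T ≤ 1 := by
    refine (ContinuousLinearMap.le_def _ _).2
      ((ContinuousLinearMap.isPositive_def').2 ⟨(IsSelfAdjoint.one _).sub hsa, fun x => ?_⟩)
    have := quadForm_le_of_trNorm_le_one h x
    rw [quadForm, ← inner_self_eq_norm_sq (𝕜 := ℂ)] at this
    rw [ContinuousLinearMap.reApplyInnerSelf_apply, ← inner_re_symm]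
    simpa [inner_sub_right] using this
  exact isPositive_cfc fun x hx =>
    eta_nonneg (spectrum_nonneg hT hx) ((CFC.le_one_iff (R := ℝ) T).1 h1 x hx)

end FunctionalCalculus

section Entropy

variable {𝓗 : Type*} [NormedAddCommGroup 𝓗] [InnerProductSpace ℂ 𝓗]
  {ι : Type*} [Fintype ι] {u : ι → 𝓗}

lemma sum_quadForm_le_of_trNorm_le_one (hu : Orthonormal ℂ u) {T : 𝓗 →L[ℂ] 𝓗}
    (hT : T.IsPositive) (h : trNorm T ≤ 1) : ∑ i, quadForm T (u i) ≤ 1 := by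
  have h1 := (tsum_quadForm_le_trNorm hu T).trans h
  rwa [tsum_fintype, ← ENNReal.ofReal_sum_of_nonneg fun i _ => quadForm_nonneg hT _,
    ENNReal.ofReal_le_one] at h1

variable [CompleteSpace 𝓗]

/-- If `σ` is diagonal in `u`, then the vectors `√σ u i` are orthogonal, so that the quadratic form
of `σ` on their normalizations sums to at most the trace of `σ`. -/
lemma sum_sq_norm_div_quadForm_le_one {σ : 𝓗 →L[ℂ] 𝓗}
    (hσ : σ.IsPositive) (htr : trNorm σ ≤ 1) (hdiag : ∀ i j, i ≠ j → ⟪u i, σ (u j)⟫_ℂ = 0)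
    (hpos : ∀ i, 0 < quadForm σ (u i)) :
    ∑ i, ‖σ (u i)‖ ^ 2 / quadForm σ (u i) ≤ 1 := by
  obtain ⟨Y, hY, hσY⟩ := exists_sqrt hσ
  have hnorm : ∀ i, ‖Y (u i)‖ = √(quadForm σ (u i)) := fun i => by
    rw [quadForm_eq_sq_norm hY hσY, Real.sqrt_sq (norm_nonneg _)]
  have hv : Orthonormal ℂ fun i => (√(quadForm σ (u i)))⁻¹ • Y (u i) := by
    refine ⟨fun i => ?_, fun i j hij => ?_⟩
    · rw [norm_smul, hnorm, norm_inv, Real.norm_of_nonneg (Real.sqrt_nonneg _),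
        inv_mul_cancel₀ (Real.sqrt_pos.2 (hpos i)).ne']
    · have : ⟪Y (u i), Y (u j)⟫_ℂ = 0 := by rw [hY, ← hσY, hdiag i j hij]
      simp only [inner_smul_right_eq_smul, inner_smul_left_eq_smul, this, smul_zero]
  refine (le_of_eq (Finset.sum_congr rfl fun i _ => ?_)).trans
    (sum_quadForm_le_of_trNorm_le_one hv hσ htr)
  rw [quadForm_smul_right, inv_pow, Real.sq_sqrt (hpos i).le, quadForm_eq_sq_norm hY hσY (Y (u i)),
    ← hσY, div_eq_inv_mul]

lemma le_entropy_of_diagonal (hu : Orthonormal ℂ u) {σ : 𝓗 →L[ℂ] 𝓗}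
    (hσ : σ.IsPositive) (htr : trNorm σ ≤ 1) (hdiag : ∀ i j, i ≠ j → ⟪u i, σ (u j)⟫_ℂ = 0)
    (hpos : ∀ i, 0 < quadForm σ (u i)) {g : ℝ} (hg : g = ∑ i, quadForm σ (u i)) (hg0 : 0 < g) :
    ENNReal.ofReal (∑ i, quadForm σ (u i) * -Real.log (quadForm σ (u i) / g)) ≤ entropy σ := by
  have hle : ∀ i, (1 - Real.log (quadForm σ (u i) / g)) * quadForm σ (u i)
      - g * (‖σ (u i)‖ ^ 2 / quadForm σ (u i)) ≤ quadForm (cfc eta σ) (u i) := fun i => by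
    have h := quadratic_le_quadForm_cfc hσ continuous_eta
      (fun t ht => quadratic_le_eta ht (div_pos (hpos i) hg0)) (u i)
    refine le_trans (le_of_eq ?_) h
    rw [inv_div]
    ring
  calc ENNReal.ofReal (∑ i, quadForm σ (u i) * -Real.log (quadForm σ (u i) / g))
      ≤ ENNReal.ofReal (∑ i, quadForm (cfc eta σ) (u i)) := by
        refine ENNReal.ofReal_le_ofReal (le_trans ?_ (Finset.sum_le_sum fun i _ => hle i))
        have h1 := mul_le_mul_of_nonneg_left
          (sum_sq_norm_div_quadForm_le_one hσ htr hdiag hpos) hg0.le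
        rw [Finset.mul_sum] at h1
        simp only [sub_mul, one_mul, Finset.sum_sub_distrib, ← hg, mul_neg, Finset.sum_neg_distrib,
          mul_comm (Real.log _)]
        linarith
    _ ≤ ∑ i, ENNReal.ofReal (quadForm (cfc eta σ) (u i)) := by
        rw [ENNReal.ofReal_sum_of_nonneg fun i _ =>
          quadForm_nonneg (isPositive_cfc_eta hσ htr) _]
    _ ≤ entropy σ := by
        rw [← tsum_fintype (L := .unconditional ι)]
        exact tsum_quadForm_le_trNorm hu _

/-- Gibbs' inequality for the diagonal of a positive operator supported on the span of `u`. -/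
lemma entExt_le_of_ker (hu : Orthonormal ℂ u) {C : 𝓗 →L[ℂ] 𝓗} (hC : C.IsPositive)
    (hker : ∀ x, (∀ i, ⟪u i, x⟫_ℂ = 0) → C x = 0) {r : ι → ℝ} (hr : ∀ i, 0 < r i)
    (hr1 : ∑ i, r i = 1) (hpos : 0 < ∑ i, quadForm C (u i)) :
    entExt C ≤ ENNReal.ofReal (∑ i, quadForm C (u i) * -Real.log (r i)) := by
  rw [entExt]
  split_ifs with hC0
  · exact zero_le
  set τ : ℝ := ∑ i, quadForm C (u i) with hτ
  have htr : trNorm C = ENNReal.ofReal τ := by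
    rw [trNorm_eq_tsum hu hC hker, tsum_fintype,
      ENNReal.ofReal_sum_of_nonneg fun i _ => quadForm_nonneg hC _]
  have hτr : (trNorm C).toReal = τ := by rw [htr, ENNReal.toReal_ofReal hpos.le]
  rw [hτr]
  set D : 𝓗 →L[ℂ] 𝓗 := τ⁻¹ • C with hD
  have hqD : ∀ x, quadForm D x = τ⁻¹ * quadForm C x := quadForm_smul_left _ _
  have hDpos : D.IsPositive := by
    rw [← ContinuousLinearMap.nonneg_iff_isPositive] at hC ⊢
    exact smul_nonneg (inv_nonneg.2 hpos.le) hC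
  have hDker : ∀ x, (∀ i, ⟪u i, x⟫_ℂ = 0) → D x = 0 := fun x hx => by simp [hD, hker x hx]
  have hsumD : ∑ i, quadForm D (u i) = 1 := by
    simp only [hqD]
    rw [← Finset.mul_sum, inv_mul_cancel₀ hpos.ne']
  have hDtr : trNorm D = 1 := by
    rw [trNorm_eq_tsum hu hDpos hDker, tsum_fintype,
      ← ENNReal.ofReal_sum_of_nonneg fun i _ => quadForm_nonneg hDpos _, hsumD, ENNReal.ofReal_one]
  have hE := isPositive_cfc_eta hDpos hDtr.le
  have htangent : ∀ x s, 0 < s → quadForm (cfc eta D) x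
      ≤ (-Real.log s - 1) * quadForm D x + s * ‖x‖ ^ 2 := fun x s hs => by
    simpa using quadForm_cfc_le_quadratic hDpos continuous_eta
      (fun t ht => eta_le_tangent ht hs) x
  have hEker : ∀ x, (∀ i, ⟪u i, x⟫_ℂ = 0) → cfc eta D x = 0 := fun x hx => by
    refine apply_eq_zero_of_quadForm_eq_zero hE (le_antisymm ?_ (quadForm_nonneg hE x))
    refine le_of_forall_pos_le_add fun s hs => ?_
    have hx0 : quadForm D x = 0 := by simp [quadForm, hDker x hx]
    have h := htangent x (s / (‖x‖ ^ 2 + 1)) (by positivity)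
    rw [hx0, mul_zero, zero_add, div_mul_eq_mul_div] at h
    rw [zero_add]
    refine h.trans ((div_le_iff₀ (by positivity)).2 ?_)
    nlinarith
  have hent : entropy D ≤ ENNReal.ofReal (∑ i, quadForm D (u i) * -Real.log (r i)) := by
    rw [entropy, trNorm_eq_tsum hu hE hEker, tsum_fintype,
      ← ENNReal.ofReal_sum_of_nonneg fun i _ => quadForm_nonneg hE _]
    refine ENNReal.ofReal_le_ofReal ?_
    calc ∑ i, quadForm (cfc eta D) (u i)
        ≤ ∑ i, (quadForm D (u i) * -Real.log (r i) - quadForm D (u i) + r i) :=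
          Finset.sum_le_sum fun i _ => (htangent (u i) (r i) (hr i)).trans_eq (by
            rw [hu.1 i]
            ring)
      _ = _ := by rw [Finset.sum_add_distrib, Finset.sum_sub_distrib, hsumD, hr1]; ring
  refine (mul_le_mul_right hent _).trans_eq ?_
  rw [htr, ← ENNReal.ofReal_mul hpos.le, Finset.mul_sum]
  congr 1
  refine Finset.sum_congr rfl fun i _ => ?_
  rw [hqD, ← mul_assoc, ← mul_assoc, mul_inv_cancel₀ hpos.ne', one_mul]

/-- The entropy of the truncation `[A − εI]₊` is at most that of any `q • σ ≥ A − εI`. -/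
lemma entExt_cutAbove_le {A σ : 𝓗 →L[ℂ] 𝓗} (hA : A.IsPositive) (htr : trNorm A ≠ ⊤)
    (hσ : IsState σ) {q ε : ℝ} (hq : 0 ≤ q) (hε : 0 < ε)
    (hle : ∀ x, quadForm A x ≤ q * quadForm σ x + ε * ‖x‖ ^ 2) :
    entExt (cutAbove A ε) ≤ ENNReal.ofReal q * entropy σ := by
  set C := cutAbove A ε with hCdef
  have hC : C.IsPositive := cutAbove_isPositive A ε
  by_cases hC0 : C = 0
  · simp [entExt, hC0]
  let V : Submodule ℂ 𝓗 := LinearMap.range (C : 𝓗 →ₗ[ℂ] 𝓗)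
  have hCV : ∀ x ∈ V, quadForm C x = quadForm A x - ε * ‖x‖ ^ 2 := by
    rintro _ ⟨y, rfl⟩
    rw [← inner_self_eq_norm_sq (𝕜 := ℂ)]
    simp only [quadForm, ContinuousLinearMap.coe_coe]
    rw [hCdef, cutAbove_apply_cutAbove hA, inner_sub_right, inner_smul_right_eq_smul]
    simp
  have hfin : FiniteDimensional ℂ V := finiteDimensional_of_le_quadForm htr hε V fun x hx => by
    linarith [hCV x hx, quadForm_nonneg hC x]
  obtain ⟨b, hdiag⟩ := exists_orthonormal_diagonalizing V hσ.1
  have hu : Orthonormal ℂ (fun i => (b i : 𝓗)) := b.orthonormal.comp_linearIsometry V.subtypeₗᵢ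
  have hker : ∀ x, (∀ i, ⟪(b i : 𝓗), x⟫_ℂ = 0) → C x = 0 := fun x hx => by
    have h : ∀ v : V, ⟪(v : 𝓗), x⟫_ℂ = 0 := fun v => by
      rw [← b.sum_repr v]
      simp [hx]
    have h2 : ⟪C (C x), x⟫_ℂ = 0 := h ⟨C (C x), C x, rfl⟩
    rwa [hC.inner_left_eq_inner_right, inner_self_eq_zero] at h2
  have hCpos : ∀ i, 0 < quadForm C (b i) := fun i => by
    refine (quadForm_nonneg hC _).lt_of_ne fun h => hu.ne_zero i ?_
    have h0 := apply_eq_zero_of_quadForm_eq_zero hC h.symm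
    obtain ⟨y, hy⟩ := (b i).2
    have hy' : C y = b i := hy
    rw [← inner_self_eq_zero (𝕜 := ℂ)]
    nth_rw 1 [← hy']
    rw [hC.inner_left_eq_inner_right, h0, inner_zero_right]
  have hCσ : ∀ i, quadForm C (b i) ≤ q * quadForm σ (b i) := fun i => by
    linarith [hCV _ (b i).2, hle (b i)]
  have hσpos : ∀ i, 0 < quadForm σ (b i) := fun i =>
    pos_of_mul_pos_right ((hCpos i).trans_le (hCσ i)) hq
  have hne : Nonempty (Fin (Module.finrank ℂ V)) := by
    by_contra h
    refine hC0 (ContinuousLinearMap.ext fun x => hker x fun i => (h ⟨i⟩).elim)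
  set g : ℝ := ∑ i, quadForm σ (b i) with hg
  have hg0 : 0 < g := Finset.sum_pos (fun i _ => hσpos i) Finset.univ_nonempty
  calc entExt C ≤ ENNReal.ofReal
        (∑ i, quadForm C (b i) * -Real.log (quadForm σ (b i) / g)) :=
        entExt_le_of_ker hu hC hker (fun i => div_pos (hσpos i) hg0)
          (by rw [← Finset.sum_div, div_self hg0.ne'])
          (Finset.sum_pos (fun i _ => hCpos i) Finset.univ_nonempty)
    _ ≤ ENNReal.ofReal (q * ∑ i, quadForm σ (b i) * -Real.log (quadForm σ (b i) / g)) := by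
        rw [Finset.mul_sum]
        refine ENNReal.ofReal_le_ofReal (Finset.sum_le_sum fun i _ => ?_)
        rw [← mul_assoc]
        refine mul_le_mul_of_nonneg_right (hCσ i) (neg_nonneg.2 (Real.log_nonpos
          (div_pos (hσpos i) hg0).le ((div_le_one hg0).2 ?_)))
        exact Finset.single_le_sum (f := fun i => quadForm σ (b i)) (fun j _ => (hσpos j).le)
          (Finset.mem_univ i)
    _ ≤ ENNReal.ofReal q * entropy σ := by
        rw [ENNReal.ofReal_mul hq]
        exact mul_le_mul_right (le_entropy_of_diagonal hu hσ.1 hσ.2.le hdiag hσpos hg hg0) _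

end Entropy

section TraceDistance

variable {𝓗 : Type*} [NormedAddCommGroup 𝓗] [InnerProductSpace ℂ 𝓗]

lemma summable_abs_quadForm {T : 𝓗 →L[ℂ] 𝓗} (hT : trNorm T ≠ ⊤) {ι : Type*}
    (b : HilbertBasis ι ℂ 𝓗) : Summable (fun i => |quadForm T (b i)|) ∧
      ∑' i, |quadForm T (b i)| ≤ (trNorm T).toReal := by
  have h := tsum_abs_quadForm_le_trNorm b.orthonormal T
  have hfin := ne_top_of_le_ne_top hT h
  have h2 := ENNReal.hasSum_toReal hfin
  rw [← ENNReal.tsum_toReal_eq (ENNReal.ne_top_of_tsum_ne_top hfin)] at h2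
  simp only [ENNReal.toReal_ofReal (abs_nonneg _)] at h2
  exact ⟨h2.summable, h2.tsum_eq.trans_le (ENNReal.toReal_mono hT h)⟩

variable [CompleteSpace 𝓗]

lemma hasSum_quadForm_of_isState {ρ : 𝓗 →L[ℂ] 𝓗} (hρ : IsState ρ) {ι : Type*}
    (b : HilbertBasis ι ℂ 𝓗) : HasSum (fun i => quadForm ρ (b i)) 1 := by
  have h := trNorm_eq_tsum_hilbertBasis b hρ.1
  rw [hρ.2] at h
  have hfin : ∑' i, ENNReal.ofReal (quadForm ρ (b i)) ≠ ⊤ := h ▸ ENNReal.one_ne_top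
  have h2 := ENNReal.hasSum_toReal hfin
  rw [← ENNReal.tsum_toReal_eq (ENNReal.ne_top_of_tsum_ne_top hfin), ← h, ENNReal.toReal_one] at h2
  simpa [ENNReal.toReal_ofReal (quadForm_nonneg hρ.1 _)] using h2

lemma hasSum_quadForm_sub {ρ σ : 𝓗 →L[ℂ] 𝓗} (hρ : IsState ρ) (hσ : IsState σ) (p q : ℝ)
    {ι : Type*} (b : HilbertBasis ι ℂ 𝓗) :
    HasSum (fun i => quadForm (p • ρ - q • σ) (b i)) (p - q) := by
  simpa [quadForm_sub_left, quadForm_smul_left] using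
    ((hasSum_quadForm_of_isState hρ b).mul_left p).sub ((hasSum_quadForm_of_isState hσ b).mul_left q)

lemma neg_trace_le_trNorm {ρ σ : 𝓗 →L[ℂ] 𝓗} (hρ : IsState ρ) (hσ : IsState σ) {p q : ℝ}
    (h : trNorm (p • ρ - q • σ) ≠ ⊤) : q - p ≤ (trNorm (p • ρ - q • σ)).toReal := by
  obtain ⟨w, b, -⟩ := exists_hilbertBasis ℂ 𝓗
  obtain ⟨hs, hle⟩ := summable_abs_quadForm h b
  have h1 := hasSum_le (fun i => neg_le_abs _) (hasSum_quadForm_sub hρ hσ p q b).neg hs.hasSum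
  linarith

lemma two_mul_quadForm_le {ρ σ : 𝓗 →L[ℂ] 𝓗} (hρ : IsState ρ) (hσ : IsState σ) {p q : ℝ}
    (h : trNorm (p • ρ - q • σ) ≠ ⊤) {x : 𝓗} (hx : ‖x‖ = 1) :
    2 * quadForm (p • ρ - q • σ) x ≤ (trNorm (p • ρ - q • σ)).toReal - (q - p) := by
  have hs : Orthonormal ℂ ((↑) : ({x} : Set 𝓗) → 𝓗) := by
    refine ⟨fun y => by rw [y.2, hx], fun i j hij => (hij (Subsingleton.elim i j)).elim⟩
  obtain ⟨w, b, hw, hb⟩ := hs.exists_hilbertBasis_extension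
  let j : w := ⟨x, hw rfl⟩
  have hj : b j = x := congrFun hb j
  obtain ⟨hsum, hle⟩ := summable_abs_quadForm h b
  have h1 := (hasSum_quadForm_sub hρ hσ p q b).add hsum.hasSum
  have h2 := le_hasSum h1 j fun i _ => by
    linarith [neg_abs_le (quadForm (p • ρ - q • σ) (b i))]
  rw [hj] at h2
  linarith [le_abs_self (quadForm (p • ρ - q • σ) x)]

/-- If two ensembles are `ε`-close in trace norm, then each difference `p k • ρ k − q k • σ k` is
bounded above by `ε`. -/
lemma quadForm_sub_le {p q : ℕ → ℝ} {ρ σ : ℕ → 𝓗 →L[ℂ] 𝓗} (hp : HasSum p 1) (hq : HasSum q 1)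
    (hρ : ∀ k, IsState (ρ k)) (hσ : ∀ k, IsState (σ k)) {ε : ℝ} (hε : 0 ≤ ε)
    (hdist : ∑' k, trNorm (p k • ρ k - q k • σ k) ≤ ENNReal.ofReal (2 * ε)) (k : ℕ) {x : 𝓗}
    (hx : ‖x‖ = 1) : quadForm (p k • ρ k - q k • σ k) x ≤ ε := by
  have hfin := ne_top_of_le_ne_top ENNReal.ofReal_ne_top hdist
  have hk := fun k => ENNReal.ne_top_of_tsum_ne_top hfin k
  have h1 := (ENNReal.hasSum_toReal hfin).sub (hq.sub hp)
  have h2 := le_hasSum h1 k fun i _ => sub_nonneg.2 (neg_trace_le_trNorm (hρ i) (hσ i) (hk i))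
  rw [← ENNReal.tsum_toReal_eq hk] at h2
  have h3 := ENNReal.toReal_mono ENNReal.ofReal_ne_top hdist
  rw [ENNReal.toReal_ofReal (by positivity)] at h3
  linarith [two_mul_quadForm_le (hρ k) (hσ k) (hk k) hx]

end TraceDistance

/-- Corollary 8: universal local lower bound for the average entropy
of an ensemble of quantum states. -/
theorem stmt19
    {𝓗 : Type*} [NormedAddCommGroup 𝓗] [InnerProductSpace ℂ 𝓗] [CompleteSpace 𝓗]
    (p : ℕ → ℝ) (ρ : ℕ → 𝓗 →L[ℂ] 𝓗)
    (hp : ∀ k, 0 ≤ p k) (hp1 : ∑' k, p k = 1) (hρ : ∀ k, IsState (ρ k))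
    (q : ℕ → ℝ) (σ : ℕ → 𝓗 →L[ℂ] 𝓗)
    (hq : ∀ k, 0 ≤ q k) (hq1 : ∑' k, q k = 1) (hσ : ∀ k, IsState (σ k))
    (ε : ℝ) (hε0 : 0 < ε) (hε1 : ε ≤ 1)
    (hdist : ∑' k, trNorm (p k • ρ k - q k • σ k) ≤ ENNReal.ofReal (2 * ε)) :
    ∑' k, entExt (cutAbove (p k • ρ k) ε)
      ≤ (∑' k, ENNReal.ofReal (q k) * entropy (σ k)) + ENNReal.ofReal (binEntUp ε) := by
  have hasSum_one : ∀ f : ℕ → ℝ, ∑' k, f k = 1 → HasSum f 1 := fun f hf => by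
    refine hf ▸ Summable.hasSum ?_
    by_contra h
    simp [tsum_eq_zero_of_not_summable h] at hf
  -- the bound holds even without the binary entropy term
  refine le_trans (ENNReal.tsum_le_tsum fun k => ?_) le_self_add
  have hA : (p k • ρ k).IsPositive := by
    have h := hρ k |>.1
    rw [← ContinuousLinearMap.nonneg_iff_isPositive] at h ⊢
    exact smul_nonneg (hp k) h
  have htr : trNorm (p k • ρ k) ≠ ⊤ := by
    obtain ⟨w, b, -⟩ := exists_hilbertBasis ℂ 𝓗
    rw [trNorm_eq_tsum_hilbertBasis b hA]
    simp only [quadForm_smul_left, ENNReal.ofReal_mul (hp k)]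
    rw [ENNReal.tsum_mul_left, ← trNorm_eq_tsum_hilbertBasis b (hρ k).1, (hρ k).2, mul_one]
    exact ENNReal.ofReal_ne_top
  refine entExt_cutAbove_le hA htr (hσ k) (hq k) hε0 fun x => ?_
  by_cases hx : x = 0
  · simp [hx, quadForm]
  have hn : 0 < ‖x‖ := norm_pos_iff.2 hx
  have h := quadForm_sub_le (hasSum_one p hp1) (hasSum_one q hq1) hρ hσ hε0.le hdist k
    (x := (‖x‖⁻¹ : ℝ) • x) (by rw [norm_smul, norm_inv, norm_norm, inv_mul_cancel₀ hn.ne'])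
  rw [quadForm_smul_right, inv_pow, inv_mul_le_iff₀ (by positivity), quadForm_sub_left,
    quadForm_smul_left (q k)] at h
  linarith

end AFW
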